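/- Let (Γ, μ) be a probability space and T : Γ → Γ a measure-preserving map. Let ε, k be real numbers with 0 < ε and 1 ≤ k ≤ 1/ε, and let E ⊆ Γ be a measurable set with μ(E) = 1 − ε. Let G be the set of points x ∈ Γ at which the Birkhoff time average Â_E(x) = lim_{n→∞} (1/n) ∑_{i=0}^{n−1} 1_E(T^i x) exists and satisfies Â_E(x) ≥ 1 − kε. Then μ(G) > 1 − 1/k. -/

import Mathlib

open MeasureTheory Filter

/-- The discrete Birkhoff time average up to time `n` of the set `A`
along the orbit of `x` under the map `T`. -/
noncomputable def birkhoffAvg {Γ : Type*} (T : Γ → Γ) (A : Set Γ) (n : ℕ) (x : Γ) : ℝ :=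
  (n : ℝ)⁻¹ * ∑ i ∈ Finset.range n, A.indicator (fun _ => (1 : ℝ)) (T^[i] x)

/-- The maximum of `0` and the Birkhoff sums of `g` of length at most `n`. -/
noncomputable def birkhoffMaxSum {Γ : Type*} (T : Γ → Γ) (g : Γ → ℝ) : ℕ → Γ → ℝ
  | 0, _ => 0
  | n + 1, x => max 0 (g x + birkhoffMaxSum T g n (T x))

section MaxSum

variable {Γ : Type*} {T : Γ → Γ} {g : Γ → ℝ}

lemma birkhoffMaxSum_nonneg (n : ℕ) (x : Γ) : 0 ≤ birkhoffMaxSum T g n x := by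
  cases n with
  | zero => exact le_rfl
  | succ n => exact le_max_left _ _

lemma birkhoffMaxSum_le_succ (n : ℕ) (x : Γ) :
    birkhoffMaxSum T g n x ≤ birkhoffMaxSum T g (n + 1) x := by
  induction n generalizing x with
  | zero => exact birkhoffMaxSum_nonneg _ _
  | succ n ih => exact max_le_max le_rfl (add_le_add le_rfl (ih _))

lemma birkhoffSum_le_birkhoffMaxSum (n : ℕ) (x : Γ) :
    birkhoffSum T g n x ≤ birkhoffMaxSum T g n x := by
  induction n generalizing x with
  | zero => simp [birkhoffMaxSum]
  | succ n ih =>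
    rw [birkhoffSum_succ']
    exact le_max_of_le_right (add_le_add le_rfl (ih _))

variable [MeasurableSpace Γ] {μ : Measure Γ}

lemma measurable_birkhoffMaxSum (hT : Measurable T) (hg : Measurable g) (n : ℕ) :
    Measurable (birkhoffMaxSum T g n) := by
  induction n with
  | zero => exact measurable_const
  | succ n ih => exact measurable_const.max (hg.add (ih.comp hT))

lemma integrable_birkhoffMaxSum (hT : MeasurePreserving T μ μ) (hg : Integrable g μ) (n : ℕ) :
    Integrable (birkhoffMaxSum T g n) μ := by
  induction n with
  | zero => exact integrable_zero _ _ _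
  | succ n ih =>
    exact (integrable_zero _ _ _).sup (hg.add (hT.integrable_comp_of_integrable ih))

/-- The finite-horizon maximal ergodic inequality. -/
lemma setIntegral_birkhoffMaxSum_pos_nonneg (hT : MeasurePreserving T μ μ) (hgm : Measurable g)
    (hg : Integrable g μ) (n : ℕ) :
    0 ≤ ∫ x in {x | 0 < birkhoffMaxSum T g n x}, g x ∂μ := by
  cases n with
  | zero => simp [birkhoffMaxSum]
  | succ n =>
    have hm := measurable_birkhoffMaxSum hT.measurable hgm (n + 1)
    have hi := integrable_birkhoffMaxSum hT hg (n + 1)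
    have hS : MeasurableSet {x | 0 < birkhoffMaxSum T g (n + 1) x} :=
      measurableSet_lt measurable_const hm
    have hiT : Integrable (fun x => birkhoffMaxSum T g (n + 1) (T x)) μ :=
      hT.integrable_comp_of_integrable hi
    have hint : ∫ x, birkhoffMaxSum T g (n + 1) (T x) ∂μ
        = ∫ x, birkhoffMaxSum T g (n + 1) x ∂μ := by
      have h := integral_map (μ := μ) hT.measurable.aemeasurable
        (f := birkhoffMaxSum T g (n + 1)) hm.aestronglyMeasurable
      rw [hT.map_eq] at h
      exact h.symm
    rw [← integral_indicator hS]
    calc (0 : ℝ) = ∫ x, (birkhoffMaxSum T g (n + 1) x - birkhoffMaxSum T g (n + 1) (T x)) ∂μ := by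
          rw [integral_sub hi hiT, hint, sub_self]
      _ ≤ _ := by
          refine integral_mono (hi.sub hiT) (hg.indicator hS) fun x => ?_
          have h1 := birkhoffMaxSum_le_succ (T := T) (g := g) n (T x)
          have h2 := birkhoffMaxSum_nonneg (T := T) (g := g) (n + 1) (T x)
          by_cases hx : 0 < birkhoffMaxSum T g (n + 1) x
          · rw [Set.indicator_of_mem (by exact hx)]
            have h3 : birkhoffMaxSum T g (n + 1) x = g x + birkhoffMaxSum T g n (T x) :=
              max_eq_right (not_lt.1 fun h => hx.ne' (max_eq_left h.le))
            linarith
          · rw [Set.indicator_of_notMem (by exact hx)]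
            linarith

/-- If every orbit has a positive Birkhoff sum of `g`, then `g` has nonnegative integral. -/
lemma integral_nonneg_of_exists_birkhoffSum_pos (hT : MeasurePreserving T μ μ)
    (hgm : Measurable g) (hg : Integrable g μ) (hpos : ∀ x, ∃ n, 0 < birkhoffSum T g n x) :
    0 ≤ ∫ x, g x ∂μ := by
  have hU : ⋃ n, {x | 0 < birkhoffMaxSum T g n x} = Set.univ :=
    Set.eq_univ_of_forall fun x => Set.mem_iUnion.2 <|
      (hpos x).imp fun n hn => hn.trans_le (birkhoffSum_le_birkhoffMaxSum n x)
  have ht := tendsto_setIntegral_of_monotone (μ := μ) (f := g)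
    (s := fun n => {x | 0 < birkhoffMaxSum T g n x})
    (fun n => measurableSet_lt measurable_const
      (measurable_birkhoffMaxSum hT.measurable hgm n))
    (monotone_nat_of_le_succ fun n x hx => lt_of_lt_of_le hx (birkhoffMaxSum_le_succ n x))
    hg.integrableOn
  rw [hU, setIntegral_univ] at ht
  exact ge_of_tendsto' ht fun n => setIntegral_birkhoffMaxSum_pos_nonneg hT hgm hg n

end MaxSum

lemma limsup_le_limsup_of_tendsto_sub_zero {u v : ℕ → ℝ}
    (hu : IsCoboundedUnder (· ≤ ·) atTop u) (hv : IsBoundedUnder (· ≤ ·) atTop v)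
    (huv : Tendsto (fun n => u n - v n) atTop (nhds 0)) :
    limsup u atTop ≤ limsup v atTop := by
  refine le_of_forall_pos_le_add fun δ hδ => limsup_le_of_le hu ?_
  filter_upwards [huv.eventually_lt_const (half_pos hδ),
    eventually_lt_of_limsup_lt (lt_add_of_pos_right (limsup v atTop) (half_pos hδ)) hv]
    with n h1 h2
  linarith

section Limsup

variable {Γ : Type*} {T : Γ → Γ} {f : Γ → ℝ}

lemma birkhoffAverage_mem_Icc (hf : ∀ x, f x ∈ Set.Icc (0 : ℝ) 1) (n : ℕ) (x : Γ) :
    birkhoffAverage ℝ T f n x ∈ Set.Icc (0 : ℝ) 1 := by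
  have h0 : 0 ≤ birkhoffSum T f n x := Finset.sum_nonneg fun i _ => (hf _).1
  have h1 : birkhoffSum T f n x ≤ n := by
    simpa [birkhoffSum] using Finset.sum_le_sum (s := Finset.range n) fun i _ => (hf (T^[i] x)).2
  rw [birkhoffAverage, smul_eq_mul]
  exact ⟨by positivity, (mul_le_mul_of_nonneg_left h1 (by positivity)).trans
    (inv_mul_le_one (a := (n : ℝ)))⟩

lemma isBoundedUnder_birkhoffAverage (hf : ∀ x, f x ∈ Set.Icc (0 : ℝ) 1) (x : Γ) :
    IsBoundedUnder (· ≤ ·) atTop (fun n => birkhoffAverage ℝ T f n x) :=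
  isBoundedUnder_of ⟨1, fun n => (birkhoffAverage_mem_Icc hf n x).2⟩

lemma isCoboundedUnder_birkhoffAverage (hf : ∀ x, f x ∈ Set.Icc (0 : ℝ) 1) (x : Γ) :
    IsCoboundedUnder (· ≤ ·) atTop (fun n => birkhoffAverage ℝ T f n x) :=
  (isBoundedUnder_of (r := (· ≥ ·))
    ⟨0, fun n => (birkhoffAverage_mem_Icc hf n x).1⟩).isCoboundedUnder_le

/-- The upper Birkhoff time average of `f` along the orbit of `x` under `T`. -/
noncomputable def birkhoffLimsup (T : Γ → Γ) (f : Γ → ℝ) (x : Γ) : ℝ :=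
  limsup (fun n => birkhoffAverage ℝ T f n x) atTop

lemma birkhoffLimsup_mem_Icc (hf : ∀ x, f x ∈ Set.Icc (0 : ℝ) 1) (x : Γ) :
    birkhoffLimsup T f x ∈ Set.Icc (0 : ℝ) 1 :=
  ⟨le_limsup_of_frequently_le
      (Frequently.of_forall fun n => (birkhoffAverage_mem_Icc hf n x).1)
      (isBoundedUnder_birkhoffAverage hf x),
    limsup_le_of_le (isCoboundedUnder_birkhoffAverage hf x)
      (Eventually.of_forall fun n => (birkhoffAverage_mem_Icc hf n x).2)⟩

lemma eventually_birkhoffAverage_lt (hf : ∀ x, f x ∈ Set.Icc (0 : ℝ) 1) (x : Γ) {δ : ℝ}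
    (hδ : 0 < δ) : ∀ᶠ n in atTop, birkhoffAverage ℝ T f n x < birkhoffLimsup T f x + δ :=
  eventually_lt_of_limsup_lt (lt_add_of_pos_right _ hδ) (isBoundedUnder_birkhoffAverage hf x)

lemma birkhoffLimsup_apply (hf : ∀ x, f x ∈ Set.Icc (0 : ℝ) 1) (x : Γ) :
    birkhoffLimsup T f (T x) = birkhoffLimsup T f x := by
  have hb : Bornology.IsBounded (Set.range fun n => f (T^[n] x)) :=
    (Metric.isBounded_Icc (0 : ℝ) 1).subset (Set.range_subset_iff.2 fun n => hf _)
  have h := tendsto_birkhoffAverage_apply_sub_birkhoffAverage ℝ hb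
  refine le_antisymm
    (limsup_le_limsup_of_tendsto_sub_zero (isCoboundedUnder_birkhoffAverage hf _)
      (isBoundedUnder_birkhoffAverage hf _) h)
    (limsup_le_limsup_of_tendsto_sub_zero (isCoboundedUnder_birkhoffAverage hf _)
      (isBoundedUnder_birkhoffAverage hf _) ?_)
  simpa using h.neg

lemma birkhoffLimsup_iterate (hf : ∀ x, f x ∈ Set.Icc (0 : ℝ) 1) (n : ℕ) (x : Γ) :
    birkhoffLimsup T f (T^[n] x) = birkhoffLimsup T f x := by
  induction n with
  | zero => rfl
  | succ n ih => rw [Function.iterate_succ_apply', birkhoffLimsup_apply hf, ih]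

variable [MeasurableSpace Γ] {μ : Measure Γ}

lemma measurable_birkhoffLimsup (hT : Measurable T) (hf : Measurable f) :
    Measurable (birkhoffLimsup T f) :=
  Measurable.limsup fun n =>
    (Finset.measurable_sum _ fun i _ => hf.comp (hT.iterate i)).const_smul ((n : ℝ)⁻¹)

lemma integrable_of_forall_mem_Icc [IsFiniteMeasure μ] (hfm : Measurable f)
    (hf : ∀ x, f x ∈ Set.Icc (0 : ℝ) 1) : Integrable f μ :=
  Integrable.of_bound hfm.aestronglyMeasurable 1 <| Eventually.of_forall fun x => by
    rw [Real.norm_of_nonneg (hf x).1]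
    exact (hf x).2

lemma integral_birkhoffLimsup_le [IsProbabilityMeasure μ] (hT : MeasurePreserving T μ μ)
    (hfm : Measurable f) (hf : ∀ x, f x ∈ Set.Icc (0 : ℝ) 1) :
    ∫ x, birkhoffLimsup T f x ∂μ ≤ ∫ x, f x ∂μ := by
  refine le_of_forall_pos_le_add fun δ hδ => ?_
  have hUm := measurable_birkhoffLimsup hT.measurable hfm
  have hUi := integrable_of_forall_mem_Icc (μ := μ) hUm (birkhoffLimsup_mem_Icc hf)
  have hfi := integrable_of_forall_mem_Icc (μ := μ) hfm hf
  have key := integral_nonneg_of_exists_birkhoffSum_pos hT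
    (g := fun x => f x - birkhoffLimsup T f x + δ) ((hfm.sub hUm).add_const δ)
    ((hfi.sub hUi).add (integrable_const δ)) fun x => by
      have hfr : ∃ᶠ n in atTop, birkhoffLimsup T f x - δ < birkhoffAverage ℝ T f n x :=
        frequently_lt_of_lt_limsup (isCoboundedUnder_birkhoffAverage hf x) (sub_lt_self _ hδ)
      obtain ⟨n, hn, hn0⟩ := (hfr.and_eventually (eventually_gt_atTop 0)).exists
      refine ⟨n, ?_⟩
      have hn0' : (0 : ℝ) < n := Nat.cast_pos.2 hn0
      have hs : birkhoffSum T (fun x => f x - birkhoffLimsup T f x + δ) n x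
          = birkhoffSum T f n x - n * (birkhoffLimsup T f x - δ) := by
        simp only [birkhoffSum, birkhoffLimsup_iterate hf, Finset.sum_add_distrib,
          Finset.sum_sub_distrib, Finset.sum_const, Finset.card_range, nsmul_eq_mul]
        ring
      rw [birkhoffAverage, smul_eq_mul, lt_inv_mul_iff₀ hn0'] at hn
      rw [hs]
      linarith
  have hsum : ∫ x, (f x - birkhoffLimsup T f x + δ) ∂μ
      = ∫ x, f x ∂μ - ∫ x, birkhoffLimsup T f x ∂μ + δ := by
    rw [integral_add (by exact hfi.sub hUi) (integrable_const δ), integral_sub hfi hUi]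
    simp
  linarith

end Limsup

section Complement

variable {Γ : Type*} {T : Γ → Γ} {f : Γ → ℝ}

lemma one_sub_mem_Icc (hf : ∀ x, f x ∈ Set.Icc (0 : ℝ) 1) (x : Γ) :
    1 - f x ∈ Set.Icc (0 : ℝ) 1 :=
  ⟨sub_nonneg.2 (hf x).2, sub_le_self _ (hf x).1⟩

lemma birkhoffAverage_one_sub {n : ℕ} (hn : 0 < n) (x : Γ) :
    birkhoffAverage ℝ T (fun x => 1 - f x) n x = 1 - birkhoffAverage ℝ T f n x := by
  have hn0 : (n : ℝ) ≠ 0 := Nat.cast_ne_zero.2 hn.ne'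
  simp only [birkhoffAverage, birkhoffSum, Finset.sum_sub_distrib, Finset.sum_const,
    Finset.card_range, nsmul_eq_mul, smul_eq_mul]
  field_simp

lemma one_le_birkhoffLimsup_add (hf : ∀ x, f x ∈ Set.Icc (0 : ℝ) 1) (x : Γ) :
    1 ≤ birkhoffLimsup T f x + birkhoffLimsup T (fun x => 1 - f x) x := by
  refine le_of_forall_pos_le_add fun δ hδ => ?_
  obtain ⟨n, ⟨h1, h2⟩, hn⟩ := (((eventually_birkhoffAverage_lt (T := T) hf x (half_pos hδ)).and
    (eventually_birkhoffAverage_lt (T := T) (one_sub_mem_Icc hf) x (half_pos hδ))).and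
    (eventually_gt_atTop 0)).exists
  rw [birkhoffAverage_one_sub hn] at h2
  linarith

lemma tendsto_birkhoffAverage_of_birkhoffLimsup_add_eq_one (hf : ∀ x, f x ∈ Set.Icc (0 : ℝ) 1)
    {x : Γ} (hx : birkhoffLimsup T f x + birkhoffLimsup T (fun x => 1 - f x) x = 1) :
    Tendsto (fun n => birkhoffAverage ℝ T f n x) atTop (nhds (birkhoffLimsup T f x)) := by
  refine Metric.tendsto_nhds.2 fun δ hδ => ?_
  filter_upwards [eventually_birkhoffAverage_lt (T := T) hf x hδ,
    eventually_birkhoffAverage_lt (T := T) (one_sub_mem_Icc hf) x hδ, eventually_gt_atTop 0]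
    with n h1 h2 hn
  rw [birkhoffAverage_one_sub hn] at h2
  rw [Real.dist_eq, abs_lt]
  constructor <;> linarith

variable [MeasurableSpace Γ] {μ : Measure Γ} [IsProbabilityMeasure μ]

lemma ae_birkhoffLimsup_add_eq_one (hT : MeasurePreserving T μ μ) (hfm : Measurable f)
    (hf : ∀ x, f x ∈ Set.Icc (0 : ℝ) 1) :
    ∀ᵐ x ∂μ, birkhoffLimsup T f x + birkhoffLimsup T (fun x => 1 - f x) x = 1 := by
  have hcm : Measurable fun x => 1 - f x := measurable_const.sub hfm
  have hUi := integrable_of_forall_mem_Icc (μ := μ)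
    (measurable_birkhoffLimsup hT.measurable hfm) (birkhoffLimsup_mem_Icc hf)
  have hVi := integrable_of_forall_mem_Icc (μ := μ)
    (measurable_birkhoffLimsup hT.measurable hcm) (birkhoffLimsup_mem_Icc (one_sub_mem_Icc hf))
  have hU := integral_birkhoffLimsup_le hT hfm hf
  have hV := integral_birkhoffLimsup_le hT hcm (one_sub_mem_Icc hf)
  rw [integral_sub (integrable_const 1) (integrable_of_forall_mem_Icc hfm hf)] at hV
  have hnn : 0 ≤ fun x => birkhoffLimsup T f x + birkhoffLimsup T (fun x => 1 - f x) x - 1 :=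
    fun x => sub_nonneg.2 (one_le_birkhoffLimsup_add hf x)
  have hzero : ∫ x, (birkhoffLimsup T f x + birkhoffLimsup T (fun x => 1 - f x) x - 1) ∂μ = 0 := by
    refine le_antisymm ?_ (integral_nonneg hnn)
    rw [integral_sub (by exact hUi.add hVi) (integrable_const 1), integral_add hUi hVi]
    linarith
  filter_upwards [(integral_eq_zero_iff_of_nonneg hnn
    ((hUi.add hVi).sub (integrable_const 1))).1 hzero] with x hx
  exact sub_eq_zero.1 hx

end Complement

/-- A strict form of Markov's inequality. -/
lemma mul_measureReal_lt_of_integral_le {Γ : Type*} [MeasurableSpace Γ] {μ : Measure Γ}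
    [IsFiniteMeasure μ] {V : Γ → ℝ} (hVm : Measurable V) (hVi : Integrable V μ)
    (hV : ∀ x, 0 ≤ V x) {c a : ℝ} (ha : 0 < a) (hint : ∫ x, V x ∂μ ≤ a) :
    c * μ.real {x | c < V x} < a := by
  have hS : MeasurableSet {x | c < V x} := measurableSet_lt measurable_const hVm
  rcases eq_or_ne (μ {x | c < V x}) 0 with h0 | h0
  · simpa [measureReal_def, h0] using ha
  · have hi : IntegrableOn (fun x => V x - c) {x | c < V x} μ :=
      (hVi.sub (integrable_const c)).integrableOn
    have hpos : 0 < ∫ x in {x | c < V x}, (V x - c) ∂μ := by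
      rw [setIntegral_pos_iff_support_of_nonneg_ae _ hi]
      · refine (pos_iff_ne_zero.2 h0).trans_le (measure_mono fun x hx => ⟨?_, hx⟩)
        exact (sub_pos.2 hx).ne'
      · filter_upwards [ae_restrict_mem hS] with x hx
        exact (sub_pos.2 hx).le
    rw [integral_sub hVi.integrableOn (integrable_const c), setIntegral_const,
      smul_eq_mul] at hpos
    have hle := setIntegral_le_integral (s := {x | c < V x}) hVi (Eventually.of_forall hV)
    linarith

theorem stmt_1 {Γ : Type*} [MeasurableSpace Γ] (μ : Measure Γ) [IsProbabilityMeasure μ]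
    (T : Γ → Γ) (hT : MeasurePreserving T μ μ)
    (ε k : ℝ) (hε : 0 < ε) (hk1 : 1 ≤ k) (hk2 : k ≤ 1 / ε)
    (E : Set Γ) (hE : MeasurableSet E) (hEμ : μ E = ENNReal.ofReal (1 - ε))
    (G : Set Γ)
    (hG : G = {x : Γ | ∃ L : ℝ,
      Tendsto (fun n => birkhoffAvg T E n x) atTop (nhds L) ∧ 1 - k * ε ≤ L}) :
    ENNReal.ofReal (1 - 1 / k) < μ G := by
  set f : Γ → ℝ := E.indicator fun _ => (1 : ℝ) with hfdef
  have hk0 : 0 < k := one_pos.trans_le hk1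
  have hfm : Measurable f := measurable_const.indicator hE
  have hf : ∀ x, f x ∈ Set.Icc (0 : ℝ) 1 := fun x => by
    by_cases hx : x ∈ E <;> simp [hfdef, hx]
  have hcm : Measurable fun x => 1 - f x := measurable_const.sub hfm
  have hε1 : ε ≤ 1 := by
    have := hk1.trans hk2
    rwa [le_div_iff₀ hε, one_mul] at this
  have hint : ∫ x, f x ∂μ = 1 - ε := by
    rw [hfdef, integral_indicator hE, setIntegral_const, smul_eq_mul, mul_one, measureReal_def,
      hEμ, ENNReal.toReal_ofReal (sub_nonneg.2 hε1)]
  have hVm := measurable_birkhoffLimsup hT.measurable hcm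
  have hVmem := birkhoffLimsup_mem_Icc (T := T) (one_sub_mem_Icc hf)
  have hV : ∫ x, birkhoffLimsup T (fun x => 1 - f x) x ∂μ ≤ ε := by
    refine (integral_birkhoffLimsup_le hT hcm (one_sub_mem_Icc hf)).trans_eq ?_
    rw [integral_sub (integrable_const 1) (integrable_of_forall_mem_Icc hfm hf), hint]
    simp
  have hbad := mul_measureReal_lt_of_integral_le (c := k * ε) hVm
    (integrable_of_forall_mem_Icc hVm hVmem) (fun x => (hVmem x).1) hε hV
  set S := {x | k * ε < birkhoffLimsup T (fun x => 1 - f x) x}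
  have hS : MeasurableSet S := measurableSet_lt measurable_const hVm
  have hlt : 1 - 1 / k < μ.real Sᶜ := by
    rw [probReal_compl_eq_one_sub hS]
    refine sub_lt_sub_left ?_ 1
    rw [lt_div_iff₀ hk0]
    exact lt_of_mul_lt_mul_right (by linarith) hε.le
  have hsub : Sᶜ ≤ᵐ[μ] G := by
    filter_upwards [ae_birkhoffLimsup_add_eq_one hT hfm hf] with x hx hxS
    have hxS' : birkhoffLimsup T (fun x => 1 - f x) x ≤ k * ε := not_lt.1 hxS
    rw [hG]
    exact ⟨birkhoffLimsup T f x, tendsto_birkhoffAverage_of_birkhoffLimsup_add_eq_one hf hx,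
      by linarith⟩
  calc ENNReal.ofReal (1 - 1 / k) < μ Sᶜ :=
        (ENNReal.ofReal_lt_iff_lt_toReal (sub_nonneg.2 ((div_le_one hk0).2 hk1))
          (measure_ne_top _ _)).2 hlt
    _ ≤ μ G := measure_mono_ae hsub
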